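/- arXiv:2507.04071 — 2 statements merged into one kernel-verified Lean document; each statement's English description precedes it below -/
import Mathlib

section
/- Unique typing: if Γ is a context (i.e. Γ⁻¹ is a function with domain contained in the ≡_α-classes of atomic terms and ρ-terms; equivalently, every (S:P)∈Γ has S ∈ T⁰ ∪ ρT, and (S:P),(S:Q)∈Γ implies P ≡_α Q) and Γ ⊢ (S:P) and Γ ⊢ (S:Q), then P ≡_α Q. -/
namespace Paper

/-- Terms of the bare bones dependent type system (Part 1): constants `c n`,
variables `v n`, dependent products `ρR`, applications `βRS` and abstractions `λxRS`. -/
inductive Tm : Type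
  | const : ℕ → Tm
  | var : ℕ → Tm
  | rho : Tm → Tm
  | app : Tm → Tm → Tm
  | lam : ℕ → Tm → Tm → Tm
  deriving DecidableEq

namespace Tm

/-- The size of a term. -/
def size : Tm → ℕ
  | const _ => 1
  | var _ => 1
  | rho R => R.size + 1
  | app R S => R.size + S.size + 1
  | lam _ R S => R.size + S.size + 1

/-- The free variables `F(T)` of a term. -/
def fv : Tm → Finset ℕ
  | const _ => ∅
  | var x => {x}
  | rho R => R.fv
  | app R S => R.fv ∪ S.fv
  | lam x R S => R.fv ∪ (S.fv \ {x})

/-- The bound variables `B(T)` of a term. -/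
def bv : Tm → Finset ℕ
  | const _ => ∅
  | var _ => ∅
  | rho R => R.bv
  | app R S => R.bv ∪ S.bv
  | lam x R S => (R.bv ∪ S.bv) ∪ {x}

/-- All variables `V(T) = F(T) ∪ B(T)` occurring in a term. -/
def vars (t : Tm) : Finset ℕ := t.fv ∪ t.bv

/-- A fixed choice of a variable outside a given finite set of variables. -/
def fresh (s : Finset ℕ) : ℕ := s.sup id + 1

theorem fresh_not_mem (s : Finset ℕ) : fresh s ∉ s := by
  intro h
  have := Finset.le_sup (f := id) h
  simp only [id] at this
  simp only [fresh] at this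
  omega

/-- Capture-avoiding renaming `S[z/y]` (substitution of the variable `z` for the
variable `y`), implemented with a fuel parameter and carrying the fact that it
preserves the size of the term. -/
def renameAux : (n : ℕ) → (S : Tm) → S.size ≤ n → (z y : ℕ) → {t : Tm // t.size = S.size}
  | _, const a, _, _, _ => ⟨const a, rfl⟩
  | _, var v, _, z, y => if v = y then ⟨var z, rfl⟩ else ⟨var v, rfl⟩
  | 0, rho _, h, _, _ => absurd h (by simp only [size]; omega)
  | n + 1, rho R, h, z, y =>
      let R' := renameAux n R (by simp only [size] at h; omega) z y
      ⟨rho R'.1, by simp only [size, R'.2]⟩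
  | 0, app _ _, h, _, _ => absurd h (by simp only [size]; omega)
  | n + 1, app R S, h, z, y =>
      let R' := renameAux n R (by simp only [size] at h; omega) z y
      let S' := renameAux n S (by simp only [size] at h; omega) z y
      ⟨app R'.1 S'.1, by simp only [size, R'.2, S'.2]⟩
  | 0, lam _ _ _, h, _, _ => absurd h (by simp only [size]; omega)
  | n + 1, lam w R S, h, z, y =>
      let R' := renameAux n R (by simp only [size] at h; omega) z y
      if w = y ∨ y ∉ S.fv then
        ⟨lam w R'.1 S, by simp only [size, R'.2]⟩
      else if w ≠ z then
        -- here `w ∉ F(z)`, so the chosen fresh variable is `w` itself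
        let S' := renameAux n S (by simp only [size] at h; omega) z y
        ⟨lam w R'.1 S'.1, by simp only [size, R'.2, S'.2]⟩
      else
        let z' := fresh ((var z).vars ∪ S.vars)
        let S₁ := renameAux n S (by simp only [size] at h; omega) z' w
        let S₂ := renameAux n S₁.1 (by rw [S₁.2]; simp only [size] at h; omega) z y
        ⟨lam z' R'.1 S₂.1, by simp only [size, S₂.2, S₁.2, R'.2]⟩

/-- Capture-avoiding renaming `S[z/y]` of the variable `y` to the variable `z`. -/
def rename (S : Tm) (z y : ℕ) : Tm := (renameAux S.size S le_rfl z y).1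

theorem size_rename (S : Tm) (z y : ℕ) : (rename S z y).size = S.size :=
  (renameAux S.size S le_rfl z y).2

/-- Capture-avoiding substitution `S[T/x]` of the term `T` for the variable `x` in `S`,
renaming bound variables (using the fixed choice `fresh`) to avoid capture. -/
def subst : Tm → Tm → ℕ → Tm
  | const a, _, _ => const a
  | var v, T, x => if v = x then T else var v
  | rho R, T, x => rho (subst R T x)
  | app R S, T, x => app (subst R T x) (subst S T x)
  | lam w R S, T, x =>
      if w = x ∨ x ∉ S.fv then lam w (subst R T x) S
      else if w ∉ T.fv then lam w (subst R T x) (subst S T x)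
      else lam (fresh (T.vars ∪ S.vars)) (subst R T x)
        (subst (rename S (fresh (T.vars ∪ S.vars)) w) T x)
termination_by S _ _ => S.size
decreasing_by all_goals (simp only [size, size_rename]; omega)

end Tm

end Paper
namespace Paper

/-- The head α-conversion relation
`≡^α = {⟨λxRS, λyR(S[y/x])⟩ : x ∉ B(S) and y ∉ V(S)}`. -/
def HeadAlpha (A B : Tm) : Prop :=
  ∃ (x y : ℕ) (R S : Tm), x ∉ S.bv ∧ y ∉ S.vars ∧
    A = Tm.lam x R S ∧ B = Tm.lam y R (S.subst (Tm.var y) x)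

end Paper
namespace Paper

/-- The contextual closure of a relation on terms: the smallest relation
containing it such that `R ▷ C` implies `βSR ▷ βSC`, `βRS ▷ βCS`, `λxSR ▷ λxSC`,
`λxRS ▷ λxCS` and `ρR ▷ ρC`. -/
inductive Ctx (r : Tm → Tm → Prop) : Tm → Tm → Prop
  | base {R C : Tm} : r R C → Ctx r R C
  | appLeft {R C S : Tm} : Ctx r R C → Ctx r (Tm.app R S) (Tm.app C S)
  | appRight {R C S : Tm} : Ctx r R C → Ctx r (Tm.app S R) (Tm.app S C)
  | lamDom {R C S : Tm} {x : ℕ} : Ctx r R C → Ctx r (Tm.lam x R S) (Tm.lam x C S)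
  | lamBody {R C S : Tm} {x : ℕ} : Ctx r R C → Ctx r (Tm.lam x S R) (Tm.lam x S C)
  | rho {R C : Tm} : Ctx r R C → Ctx r (Tm.rho R) (Tm.rho C)

/-- α-conversion `≡_α`: the reflexive transitive contextual closure of
head α-conversion. -/
def AlphaEq : Tm → Tm → Prop := Relation.ReflTransGen (Ctx HeadAlpha)

end Paper
namespace Paper

/-- The setoid of α-conversion: the equivalence relation generated by the
contextual closure of head α-conversion (which coincides with `AlphaEq`). -/
def alphaSetoid : Setoid Tm := Relation.EqvGen.setoid (Ctx HeadAlpha)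

/-- α-equivalence classes of terms. -/
def QTm := Quotient alphaSetoid

/-- The α-equivalence class `[T]_α` of a term. -/
def cls (t : Tm) : QTm := Quotient.mk alphaSetoid t

/-- Typing statements `(S : P)`: pairs of α-equivalence classes of terms. -/
abbrev Stmt := QTm × QTm

/-- The free variables of an α-equivalence class, i.e. the union of the free
variables of its representatives (free variables are α-invariant). -/
def Fq (q : QTm) : Set ℕ := {v | ∃ T : Tm, cls T = q ∧ v ∈ T.fv}

/-- The free variables `F(Γ)` of a set of typing statements: the union of the
free variables of the subjects and predicates of its statements. -/
def FSet (Γ : Set Stmt) : Set ℕ := {v | ∃ st ∈ Γ, v ∈ Fq st.1 ∨ v ∈ Fq st.2}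

/-- The product term `πxRS := ρλxRS`. -/
def Tm.pi (x : ℕ) (R S : Tm) : Tm := Tm.rho (Tm.lam x R S)

end Paper
namespace Paper

/-- The inference relation `⊢`: the smallest sequent such that
(App): `{(F : πxPR), (S : P)} ⊢ (βFS : R[S/x])`, and
(Ab): if `x ∉ F(Γ) ∪ F(Q)` and `Γ, (x:Q) ⊢ (S : P)` then `Γ ⊢ (λxQS : πxQP)`.
The constructors `mem` and `cut` express exactly the sequent property. -/
inductive Derive : Set Stmt → Stmt → Prop
  | mem {Γ : Set Stmt} {st : Stmt} : st ∈ Γ → Derive Γ st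
  | cut {Γ Δ : Set Stmt} {st : Stmt} :
      (∀ st' ∈ Δ, Derive Γ st') → Derive Δ st → Derive Γ st
  | app (F S P R : Tm) (x : ℕ) :
      Derive {(cls F, cls (Tm.pi x P R)), (cls S, cls P)}
        (cls (Tm.app F S), cls (R.subst S x))
  | ab {Γ : Set Stmt} (Q S P : Tm) (x : ℕ) :
      x ∉ FSet Γ → x ∉ Q.fv →
      Derive (Γ ∪ {(cls (Tm.var x), cls Q)}) (cls S, cls P) →
      Derive Γ (cls (Tm.lam x Q S), cls (Tm.pi x Q P))

end Paper

namespace Paper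

/-- Atomic terms (constants and variables) and ρ-terms. -/
def Tm.atomicOrRho : Tm → Prop
  | Tm.const _ => True
  | Tm.var _ => True
  | Tm.rho _ => True
  | _ => False

/-- A context: a set of typing statements whose inverse is a function with domain
contained in the α-classes of atomic terms and ρ-terms, i.e. every subject is the
class of an atomic term or ρ-term, and each subject has at most one predicate. -/
def IsContext (Γ : Set Stmt) : Prop :=
  (∀ st ∈ Γ, ∃ S : Tm, S.atomicOrRho ∧ st.1 = cls S) ∧
    ∀ st ∈ Γ, ∀ st' ∈ Γ, st.1 = st'.1 → st.2 = st'.2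

/-- Locally nameless terms: free variables are named, bound variables are de Bruijn indices. -/
inductive LN : Type
  | const : ℕ → LN
  | fvar : ℕ → LN
  | bvar : ℕ → LN
  | rho : LN → LN
  | app : LN → LN → LN
  | lam : LN → LN → LN

namespace LN

/-- The free variables of a locally nameless term. -/
def fv : LN → Finset ℕ
  | const _ => ∅
  | fvar x => {x}
  | bvar _ => ∅
  | rho R => R.fv
  | app R S => R.fv ∪ S.fv
  | lam R S => R.fv ∪ S.fv

/-- Substitution of `u` for the free variable `x`. -/
def lsub (x : ℕ) (u : LN) : LN → LN
  | const a => const a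
  | fvar v => if v = x then u else fvar v
  | bvar i => bvar i
  | rho R => rho (lsub x u R)
  | app R S => app (lsub x u R) (lsub x u S)
  | lam R S => lam (lsub x u R) (lsub x u S)

/-- Instantiation of the bound variable with index `k` by `u`. -/
def instAt (u : LN) : ℕ → LN → LN
  | _, const a => const a
  | _, fvar v => fvar v
  | k, bvar i => if i = k then u else bvar i
  | k, rho R => rho (instAt u k R)
  | k, app R S => app (instAt u k R) (instAt u k S)
  | k, lam R S => lam (instAt u k R) (instAt u (k + 1) S)

/-- Replacement of the free variable `x` by the bound variable with index `k`. -/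
def closeAt (x : ℕ) : ℕ → LN → LN
  | _, const a => const a
  | k, fvar v => if v = x then bvar k else fvar v
  | _, bvar i => bvar i
  | k, rho R => rho (closeAt x k R)
  | k, app R S => app (closeAt x k R) (closeAt x k S)
  | k, lam R S => lam (closeAt x k R) (closeAt x (k + 1) S)

/-- All bound variables dangling in a term have index less than `k`. -/
def ClosedAt : ℕ → LN → Prop
  | _, const _ => True
  | _, fvar _ => True
  | k, bvar i => i < k
  | k, rho R => ClosedAt k R
  | k, app R S => ClosedAt k R ∧ ClosedAt k S
  | k, lam R S => ClosedAt k R ∧ ClosedAt (k + 1) S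

theorem lsub_of_notMem {x : ℕ} {u t : LN} (h : x ∉ t.fv) : lsub x u t = t := by
  induction t <;> simp_all [lsub, fv]
  grind

theorem fv_closeAt (x k : ℕ) (t : LN) : (closeAt x k t).fv = t.fv \ {x} := by
  induction t generalizing k <;> simp_all [closeAt, fv, Finset.union_sdiff_distrib]
  split_ifs with h
  · simp [h, fv]
  · simp [fv, Finset.sdiff_singleton_eq_erase, Ne.symm h]

theorem mem_fv_lsub_fvar {x y v : ℕ} {t : LN} :
    v ∈ (lsub x (fvar y) t).fv ↔ (v ∈ t.fv ∧ v ≠ x) ∨ (v = y ∧ x ∈ t.fv) := by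
  induction t <;> simp_all [lsub, fv]
  · split_ifs <;> simp_all [fv]
    grind
  · grind
  · grind

theorem closeAt_of_notMem {x k : ℕ} {t : LN} (h : x ∉ t.fv) : closeAt x k t = t := by
  induction t generalizing k <;> simp_all [closeAt, fv]
  grind

theorem closeAt_lsub {w x k : ℕ} {u t : LN} (hwx : w ≠ x) (hw : w ∉ u.fv) :
    closeAt w k (lsub x u t) = lsub x u (closeAt w k t) := by
  induction t generalizing k <;> simp_all [closeAt, lsub]
  rename_i v
  by_cases h₁ : v = x
  · subst h₁
    simp [closeAt_of_notMem hw, Ne.symm hwx, lsub]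
  · by_cases h₂ : v = w <;> simp [h₁, h₂, hwx, closeAt, lsub]

theorem closeAt_lsub_fvar {w z k : ℕ} {t : LN} (hz : z ∉ t.fv) :
    closeAt z k (lsub w (fvar z) t) = closeAt w k t := by
  induction t generalizing k <;> simp_all [closeAt, lsub, fv]
  rename_i v
  by_cases h1 : v = w <;> simp [h1, closeAt]
  grind

theorem instAt_closeAt {x k : ℕ} {u t : LN} (h : ClosedAt k t) :
    instAt u k (closeAt x k t) = lsub x u t := by
  induction t generalizing k <;> simp_all [closeAt, lsub, instAt, ClosedAt]
  · split_ifs <;> simp [instAt]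
  · omega

theorem ClosedAt.closeAt {x k : ℕ} {t : LN} (h : ClosedAt k t) :
    ClosedAt (k + 1) (closeAt x k t) := by
  induction t generalizing k <;> simp_all [LN.closeAt, ClosedAt]
  · split_ifs <;> simp [ClosedAt]
  · omega

theorem lsub_instAt {x z k : ℕ} {u t : LN} :
    lsub x (fvar z) (instAt u k t) = instAt (lsub x (fvar z) u) k (lsub x (fvar z) t) := by
  induction t generalizing k <;> simp_all [lsub, instAt]
  · split_ifs <;> simp [instAt]
  · split_ifs <;> simp [lsub]

theorem closeAt_instAt {z k : ℕ} {t : LN} (h : z ∉ t.fv) :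
    closeAt z k (instAt (fvar z) k t) = t := by
  induction t generalizing k <;> simp_all [closeAt, instAt, fv]
  · grind
  · split_ifs <;> simp_all [closeAt]

theorem instAt_fvar_injective {z k : ℕ} {t t' : LN} (ht : z ∉ t.fv) (hu : z ∉ t'.fv)
    (e : instAt (fvar z) k t = instAt (fvar z) k t') : t = t' := by
  rw [← closeAt_instAt (k := k) ht, e, closeAt_instAt hu]

/-- A cut-free typing relation on locally nameless terms, with cofinite quantification
over the variable that opens an abstraction. -/
inductive Typing : Set (LN × LN) → LN → LN → Prop
  | mem {Γ : Set (LN × LN)} {s p : LN} : (s, p) ∈ Γ → Typing Γ s p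
  | app {Γ : Set (LN × LN)} {F A P R : LN} : Typing Γ F (rho (lam P R)) → Typing Γ A P →
      Typing Γ (app F A) (instAt A 0 R)
  | lam {Γ : Set (LN × LN)} {Q B P : LN} (L : Finset ℕ) :
      (∀ z ∉ L, Typing (insert (fvar z, Q) Γ) (instAt (fvar z) 0 B) (instAt (fvar z) 0 P)) →
      Typing Γ (lam Q B) (rho (lam Q P))

namespace Typing

theorem mono {Γ Δ : Set (LN × LN)} {s p : LN} (h : Typing Γ s p) (hs : Γ ⊆ Δ) :
    Typing Δ s p := by
  induction h generalizing Δ with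
  | mem h => exact mem (hs h)
  | app _ _ ih₁ ih₂ => exact app (ih₁ hs) (ih₂ hs)
  | lam L _ ih => exact lam L fun z hz => ih z hz (Set.insert_subset_insert hs)

theorem cut {Γ Δ : Set (LN × LN)} {s p : LN} (h : Typing Δ s p)
    (hs : ∀ st ∈ Δ, Typing Γ st.1 st.2) : Typing Γ s p := by
  induction h generalizing Γ with
  | mem h => exact hs _ h
  | app _ _ ih₁ ih₂ => exact app (ih₁ hs) (ih₂ hs)
  | lam L _ ih =>
    refine lam L fun z hz => ih z hz fun st hst => ?_
    rcases hst with rfl | hst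
    · exact mem (Set.mem_insert _ _)
    · exact (hs st hst).mono (Set.subset_insert _ _)

theorem lsub_fvar {Γ : Set (LN × LN)} {s p : LN} (h : Typing Γ s p) (x y : ℕ) :
    Typing ((Prod.map (lsub x (fvar y)) (lsub x (fvar y))) '' Γ)
      (lsub x (fvar y) s) (lsub x (fvar y) p) := by
  induction h with
  | mem h => exact mem ⟨_, h, rfl⟩
  | app _ _ ih₁ ih₂ =>
    rw [lsub_instAt]
    exact app ih₁ ih₂
  | lam L _ ih =>
    refine lam (insert x L) fun z hz => ?_
    simp only [Finset.mem_insert, not_or] at hz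
    have := ih z hz.2
    simpa [lsub_instAt, lsub, hz.1, Set.image_insert_eq] using this

/-- Uniqueness of types for finite contexts whose subjects are neither applications
nor abstractions. -/
theorem unique {Γ : Set (LN × LN)} {s p q : LN} (h : Typing Γ s p) (hq : Typing Γ s q)
    (hfin : Γ.Finite) (happ : ∀ F A P, (LN.app F A, P) ∉ Γ) (hlam : ∀ Q B P, (LN.lam Q B, P) ∉ Γ)
    (hfun : ∀ s p q, (s, p) ∈ Γ → (s, q) ∈ Γ → p = q) : p = q := by
  induction h generalizing q with
  | mem h =>
    cases hq with
    | mem h' => exact hfun _ _ _ h h'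
    | app => exact absurd h (happ _ _ _)
    | lam => exact absurd h (hlam _ _ _)
  | app _ _ ih₁ ih₂ =>
    cases hq with
    | mem h' => exact absurd h' (happ _ _ _)
    | app h₁ h₂ =>
      have := ih₁ h₁ hfin happ hlam hfun
      simp only [rho.injEq, LN.lam.injEq] at this
      rw [this.2]
  | @lam Γ Q B P L _ ih =>
    cases hq with
    | mem h' => exact absurd h' (hlam _ _ _)
    | @lam _ _ _ P' L' h' =>
      obtain ⟨z, hz⟩ := Infinite.exists_notMem_finset
        (L ∪ L' ∪ P.fv ∪ P'.fv ∪ hfin.toFinset.biUnion fun st => st.1.fv)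
      simp only [Finset.mem_union, Finset.mem_biUnion, not_or, not_exists, not_and,
        Set.Finite.mem_toFinset] at hz
      obtain ⟨⟨⟨⟨hL, hL'⟩, hP⟩, hP'⟩, hΓ⟩ := hz
      have hz' : ∀ p, (fvar z, p) ∉ Γ := fun p hp => hΓ _ hp (by simp [fv])
      rw [instAt_fvar_injective hP hP' (ih z hL (h' z hL') (hfin.insert _) ?_ ?_ ?_)]
      · simpa using happ
      · simpa using hlam
      · rintro s p q (hp | hp) (hq | hq)
        · simp only [Prod.mk.injEq] at hp hq
          rw [hp.2, hq.2]
        · simp only [Prod.mk.injEq] at hp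
          exact absurd (hp.1 ▸ hq) (hz' _)
        · simp only [Prod.mk.injEq] at hq
          exact absurd (hq.1 ▸ hp) (hz' _)
        · exact hfun _ _ _ hp hq

end Typing

end LN

namespace Tm

open LN (lsub closeAt instAt ClosedAt)

/-- The locally nameless representation of a term. -/
def toLN : Tm → LN
  | const a => .const a
  | var v => .fvar v
  | rho R => .rho R.toLN
  | app R S => .app R.toLN S.toLN
  | lam x R S => .lam R.toLN (closeAt x 0 S.toLN)

theorem fv_toLN (t : Tm) : t.toLN.fv = t.fv := by
  induction t <;> simp_all [toLN, fv, LN.fv, LN.fv_closeAt]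

theorem closedAt_toLN (t : Tm) (k : ℕ) : ClosedAt k t.toLN := by
  suffices h : ∀ {j k : ℕ} {t : LN}, ClosedAt j t → j ≤ k → ClosedAt k t by
    refine h (j := 0) ?_ k.zero_le
    induction t <;> simp_all [toLN, ClosedAt]
    exact LN.ClosedAt.closeAt ‹_›
  intro j k t ht hjk
  induction t generalizing j k <;> simp_all [ClosedAt]
  · omega
  · grind
  · grind
  · rename_i ih₁ ih₂
    exact ⟨ih₁ ht.1 hjk, ih₂ ht.2 (by omega)⟩

theorem toLN_renameAux (n : ℕ) (S : Tm) (h : S.size ≤ n) (z y : ℕ) :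
    (renameAux n S h z y).1.toLN = lsub y (.fvar z) S.toLN := by
  induction n generalizing S z y with
  | zero => cases S <;> simp [size] at h
  | succ n ih =>
    cases S with
    | const a => simp [renameAux, toLN, lsub]
    | var v =>
      simp only [renameAux, toLN, lsub]
      split_ifs <;> simp [toLN]
    | rho R => simp [renameAux, toLN, lsub, ih]
    | app R S => simp [renameAux, toLN, lsub, ih]
    | lam w R S =>
      simp only [renameAux]
      split_ifs with h₁ h₂
      · have : y ∉ (closeAt w 0 S.toLN).fv := by
          rw [LN.fv_closeAt, fv_toLN]
          rcases h₁ with rfl | h₁ <;> simp_all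
        simp [toLN, lsub, ih, LN.lsub_of_notMem this]
      · push Not at h₁
        simp only [toLN, lsub, ih]
        rw [LN.closeAt_lsub h₁.1 (by simpa [LN.fv] using h₂)]
      · push Not at h₁
        have hf := fresh_not_mem ((var z).vars ∪ S.vars)
        set z' := fresh ((var z).vars ∪ S.vars)
        simp only [vars, fv, Finset.mem_union, Finset.mem_singleton, not_or] at hf
        simp only [toLN, lsub, ih]
        rw [LN.closeAt_lsub (w := z') (fun e : z' = y => hf.2.1 (e ▸ h₁.2)) (by simpa [LN.fv] using hf.1.1),
          LN.closeAt_lsub_fvar (by simpa [fv_toLN] using hf.2.1)]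

theorem toLN_rename (S : Tm) (z y : ℕ) : (rename S z y).toLN = lsub y (.fvar z) S.toLN :=
  toLN_renameAux _ _ _ _ _

theorem toLN_subst (S T : Tm) (x : ℕ) : (S.subst T x).toLN = lsub x T.toLN S.toLN := by
  induction S, T, x using subst.induct with
  | case1 a T x => simp [subst, toLN, lsub]
  | case2 T x => simp [subst, toLN, lsub]
  | case3 v T x h => simp [subst, toLN, lsub, h]
  | case4 R T x ih => simp [subst, toLN, lsub, ih]
  | case5 R S T x ih₁ ih₂ => simp [subst, toLN, lsub, ih₁, ih₂]
  | case6 w R S T x h ih =>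
    have : x ∉ (closeAt w 0 S.toLN).fv := by
      rw [LN.fv_closeAt, fv_toLN]
      rcases h with rfl | h <;> simp_all
    rw [subst, if_pos h]
    simp [toLN, lsub, ih, LN.lsub_of_notMem this]
  | case7 w R S T x h h' ih₁ ih₂ =>
    rw [subst, if_neg h, if_pos h']
    push Not at h
    simp only [toLN, lsub, ih₁, ih₂]
    rw [LN.closeAt_lsub h.1 (by rwa [fv_toLN])]
  | case8 w R S T x h h' ih₁ ih₂ =>
    rw [subst, if_neg h, if_neg h']
    push Not at h
    have hf := fresh_not_mem (T.vars ∪ S.vars)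
    set z := fresh (T.vars ∪ S.vars)
    simp only [vars, Finset.mem_union, not_or] at hf
    simp only [toLN, lsub, ih₁, ih₂, toLN_rename]
    rw [LN.closeAt_lsub (w := z) (fun e : z = x => hf.2.1 (e ▸ h.2))
      (by simpa only [fv_toLN] using hf.1.1), LN.closeAt_lsub_fvar (by simpa [fv_toLN] using hf.2.1)]

theorem mem_fv_subst_var {S : Tm} {x y v : ℕ} :
    v ∈ (S.subst (var y) x).fv ↔ (v ∈ S.fv ∧ v ≠ x) ∨ (v = y ∧ x ∈ S.fv) := by
  rw [← fv_toLN, toLN_subst, toLN, LN.mem_fv_lsub_fvar, fv_toLN]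

/-- Substituting a variable `y` not occurring in `S` for a variable `x` not bound in `S`
renames no bound variable and is undone by the reverse substitution. -/
theorem subst_var_spec {S : Tm} {x y : ℕ} (hx : x ∉ S.bv) (hy : y ∉ S.vars) :
    (S.subst (var y) x).bv = S.bv ∧ (S.subst (var y) x).size = S.size ∧
      (S.subst (var y) x).subst (var x) y = S := by
  induction S with
  | const a => simp [subst, size, bv]
  | var v =>
    have hv : v ≠ y := by rintro rfl; simp [vars, fv] at hy
    by_cases h : v = x <;> simp [subst, h, hv, size, bv]
  | rho R ih => simpa [subst, size, bv] using ih hx hy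
  | app R S ih₁ ih₂ =>
    simp only [vars, fv, bv, Finset.mem_union, not_or] at hx hy ih₁ ih₂
    simp [subst, size, bv, ih₁ hx.1 ⟨hy.1.1, hy.2.1⟩, ih₂ hx.2 ⟨hy.1.2, hy.2.2⟩]
  | lam w R S ih₁ ih₂ =>
    simp only [vars, fv, bv, Finset.mem_union, not_or, Finset.mem_sdiff,
      Finset.mem_singleton, not_and, not_not] at hx hy ih₁ ih₂
    obtain ⟨⟨hyR, hyS⟩, ⟨hyR', hyS'⟩, hyw⟩ := hy
    obtain ⟨⟨hxR, hxS⟩, hxw⟩ := hx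
    have hyS : y ∉ S.fv := fun h => hyw (hyS h)
    have h₁ := ih₁ hxR ⟨hyR, hyR'⟩
    have h₂ := ih₂ hxS ⟨hyS, hyS'⟩
    by_cases h : x ∈ S.fv
    · have e : (lam w R S).subst (var y) x
          = lam w (R.subst (var y) x) (S.subst (var y) x) := by
        rw [subst, if_neg (by simp [h, Ne.symm hxw]), if_pos (by simp [fv, Ne.symm hyw])]
      have hy' : y ∈ (S.subst (var y) x).fv := by
        exact mem_fv_subst_var.2 (.inr ⟨rfl, h⟩)
      rw [e]
      refine ⟨by simp [bv, h₁, h₂], by simp [size, h₁, h₂], ?_⟩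
      rw [subst, if_neg (by simp [hy', Ne.symm hyw]), if_pos (by simp [fv, Ne.symm hxw]),
        h₁.2.2, h₂.2.2]
    · have e : (lam w R S).subst (var y) x = lam w (R.subst (var y) x) S := by
        rw [subst, if_pos (.inr h)]
      rw [e]
      refine ⟨by simp [bv, h₁], by simp [size, h₁], ?_⟩
      rw [subst, if_pos (.inr hyS), h₁.2.2]

end Tm

open Tm

theorem HeadAlpha.toLN_eq {A B : Tm} (h : HeadAlpha A B) : A.toLN = B.toLN := by
  obtain ⟨x, y, R, S, _, hy, rfl, rfl⟩ := h
  simp only [vars, Finset.mem_union, not_or] at hy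
  simp only [toLN, toLN_subst]
  rw [LN.closeAt_lsub_fvar (by simpa [fv_toLN] using hy.1)]

theorem Ctx.toLN_eq {A B : Tm} (h : Ctx HeadAlpha A B) : A.toLN = B.toLN := by
  induction h with
  | base h => exact h.toLN_eq
  | _ => simp_all [toLN]

theorem HeadAlpha.symm {A B : Tm} (h : HeadAlpha A B) : HeadAlpha B A := by
  obtain ⟨x, y, R, S, hx, hy, rfl, rfl⟩ := h
  obtain ⟨h₁, -, h₃⟩ := subst_var_spec hx hy
  refine ⟨y, x, R, S.subst (Tm.var y) x, ?_, ?_, rfl, by rw [h₃]⟩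
  · simp only [vars, Finset.mem_union, not_or] at hy
    rw [h₁]; exact hy.2
  · simp only [vars, Finset.mem_union, not_or] at hy ⊢
    refine ⟨?_, by rwa [h₁]⟩
    rw [mem_fv_subst_var]
    rintro (h | ⟨rfl, h⟩)
    · exact h.2 rfl
    · exact hy.1 h

theorem Ctx.symm {r : Tm → Tm → Prop} (hr : ∀ {A B}, r A B → r B A) {A B : Tm}
    (h : Ctx r A B) : Ctx r B A := by
  induction h with
  | base h => exact .base (hr h)
  | appLeft _ ih => exact .appLeft ih
  | appRight _ ih => exact .appRight ih
  | lamDom _ ih => exact .lamDom ih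
  | lamBody _ ih => exact .lamBody ih
  | rho _ ih => exact .rho ih

namespace AlphaEq

theorem symm {A B : Tm} (h : AlphaEq A B) : AlphaEq B A := by
  induction h with
  | refl => exact .refl
  | tail _ h ih => exact .head (h.symm HeadAlpha.symm) ih

theorem trans {A B C : Tm} (h : AlphaEq A B) (h' : AlphaEq B C) : AlphaEq A C :=
  Relation.ReflTransGen.trans h h'

theorem rho {A B : Tm} (h : AlphaEq A B) : AlphaEq (.rho A) (.rho B) :=
  Relation.ReflTransGen.lift Tm.rho (fun _ _ => Ctx.rho) _ _ h

theorem app {A B C D : Tm} (h : AlphaEq A B) (h' : AlphaEq C D) :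
    AlphaEq (.app A C) (.app B D) :=
  trans (Relation.ReflTransGen.lift (fun T => Tm.app T C) (fun _ _ => Ctx.appLeft) _ _ h)
    (Relation.ReflTransGen.lift (Tm.app B) (fun _ _ => Ctx.appRight) _ _ h')

theorem lam {A B C D : Tm} (x : ℕ) (h : AlphaEq A B) (h' : AlphaEq C D) :
    AlphaEq (.lam x A C) (.lam x B D) :=
  trans (Relation.ReflTransGen.lift (fun T => Tm.lam x T C) (fun _ _ => Ctx.lamDom) _ _ h)
    (Relation.ReflTransGen.lift (Tm.lam x B) (fun _ _ => Ctx.lamBody) _ _ h')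

theorem toLN_eq {A B : Tm} (h : AlphaEq A B) : A.toLN = B.toLN := by
  induction h with
  | refl => rfl
  | tail _ h ih => rw [ih, h.toLN_eq]

/-- Every term is α-equivalent to one of the same size whose bound variables avoid a given
finite set. -/
theorem exists_disjoint_bv (t : Tm) (s : Finset ℕ) :
    ∃ t', AlphaEq t t' ∧ t'.size = t.size ∧ Disjoint t'.bv s := by
  induction t generalizing s with
  | const a => exact ⟨_, .refl, rfl, by simp [bv]⟩
  | var a => exact ⟨_, .refl, rfl, by simp [bv]⟩
  | rho R ih =>
    obtain ⟨R', h, hs, hd⟩ := ih s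
    exact ⟨_, h.rho, by simp [size, hs], by simpa [bv] using hd⟩
  | app R S ih₁ ih₂ =>
    obtain ⟨R', h, hs, hd⟩ := ih₁ s
    obtain ⟨S', h', hs', hd'⟩ := ih₂ s
    exact ⟨_, h.app h', by simp [size, hs, hs'], by simp [bv, hd, hd']⟩
  | lam x R S ih₁ ih₂ =>
    obtain ⟨R', h, hs, hd⟩ := ih₁ s
    obtain ⟨S', h', hs', hd'⟩ := ih₂ (insert x s)
    obtain ⟨z, hz⟩ := Infinite.exists_notMem_finset (S'.vars ∪ s)
    simp only [Finset.mem_union, not_or] at hz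
    simp only [Finset.disjoint_insert_right] at hd'
    obtain ⟨h₁, h₂, -⟩ := subst_var_spec hd'.1 hz.1
    refine ⟨.lam z R' (S'.subst (.var z) x), (lam x h h').tail
      (.base ⟨x, z, R', S', hd'.1, hz.1, rfl, rfl⟩), by simp [size, hs, hs', h₂], ?_⟩
    simp [bv, hd, h₁, hd'.2, hz.2]

theorem lam_rename (x : ℕ) (R S : Tm) :
    ∃ t : Finset ℕ, ∀ z ∉ t, ∃ S', S'.size = S.size ∧ AlphaEq (.lam x R S) (.lam z R S') ∧
      S'.toLN = LN.instAt (.fvar z) 0 (LN.closeAt x 0 S.toLN) := by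
  obtain ⟨S', h', hs', hd'⟩ := exists_disjoint_bv S {x}
  simp only [Finset.disjoint_singleton_right] at hd'
  refine ⟨S'.vars, fun z hz => ⟨S'.subst (.var z) x, ?_, ?_, ?_⟩⟩
  · rw [(subst_var_spec hd' hz).2.1, hs']
  · exact (lam x .refl h').tail (.base ⟨x, z, R, S', hd', hz, rfl, rfl⟩)
  · rw [toLN_subst, LN.instAt_closeAt (closedAt_toLN _ _), h'.toLN_eq, toLN]

theorem of_toLN_eq {A B : Tm} (h : A.toLN = B.toLN) : AlphaEq A B := by
  induction hn : A.size using Nat.strong_induction_on generalizing A B with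
  | _ n ih =>
    subst hn
    cases A <;> cases B <;> simp only [toLN, reduceCtorEq, LN.const.injEq, LN.fvar.injEq,
      LN.rho.injEq, LN.app.injEq, LN.lam.injEq] at h
    case const.const => subst h; exact .refl
    case var.var => subst h; exact .refl
    case rho.rho => exact (ih _ (by simp [size]) h rfl).rho
    case app.app =>
      exact (ih _ (by simp only [size]; omega) h.1 rfl).app
        (ih _ (by simp only [size]; omega) h.2 rfl)
    case lam.lam x R S x' R' S' =>
      obtain ⟨t, ht⟩ := lam_rename x R S
      obtain ⟨t', ht'⟩ := lam_rename x' R' S'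
      obtain ⟨z, hz⟩ := Infinite.exists_notMem_finset (t ∪ t')
      simp only [Finset.mem_union, not_or] at hz
      obtain ⟨U, hU, hα, hl⟩ := ht z hz.1
      obtain ⟨U', hU', hα', hl'⟩ := ht' z hz.2
      refine hα.trans (.trans (lam z (ih _ (by simp only [size]; omega) h.1 rfl)
        (ih U.size (by simp only [size]; omega) ?_ rfl)) hα'.symm)
      rw [hl, hl', h.2]

end AlphaEq

theorem toLN_eq_of_equiv {A B : Tm} (h : alphaSetoid A B) : A.toLN = B.toLN := by
  induction h with
  | rel _ _ h => exact h.toLN_eq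
  | refl => rfl
  | symm _ _ _ ih => exact ih.symm
  | trans _ _ _ _ _ ih₁ ih₂ => exact ih₁.trans ih₂

/-- The locally nameless representation of an α-equivalence class. -/
def QTm.toLN : QTm → LN := Quotient.lift Tm.toLN fun _ _ => toLN_eq_of_equiv

theorem QTm.toLN_cls (t : Tm) : (cls t).toLN = t.toLN := rfl

theorem AlphaEq.cls_eq {A B : Tm} (h : AlphaEq A B) : cls A = cls B := by
  induction h with
  | refl => rfl
  | tail _ h ih => exact ih.trans (Quotient.sound (Relation.EqvGen.rel _ _ h))

theorem QTm.toLN_injective : Function.Injective QTm.toLN := by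
  intro a b h
  induction a using Quotient.ind
  induction b using Quotient.ind
  exact (AlphaEq.of_toLN_eq h).cls_eq

theorem QTm.mem_Fq_of_mem_fv {q : QTm} {x : ℕ} (h : x ∈ q.toLN.fv) : x ∈ Fq q := by
  induction q using Quotient.ind with
  | _ t => exact ⟨t, rfl, by rwa [← fv_toLN]⟩

/-- The locally nameless representation of a typing statement. -/
def Stmt.toLN (st : Stmt) : LN × LN := (st.1.toLN, st.2.toLN)

namespace Derive

theorem toTyping {Γ : Set Stmt} {st : Stmt} (h : Derive Γ st) :
    LN.Typing (Stmt.toLN '' Γ) st.1.toLN st.2.toLN := by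
  induction h with
  | mem h => exact .mem ⟨_, h, rfl⟩
  | cut _ _ ih₁ ih₂ =>
    refine ih₂.cut ?_
    rintro _ ⟨st, hst, rfl⟩
    exact ih₁ st hst
  | app F S P R x =>
    simp only [QTm.toLN_cls, Tm.toLN, toLN_subst]
    rw [← LN.instAt_closeAt (k := 0) (closedAt_toLN R 0)]
    refine .app (P := P.toLN) (.mem ⟨_, .inl rfl, rfl⟩) (.mem ⟨_, .inr rfl, rfl⟩)
  | @ab Γ Q S P x hΓ hQ _ ih =>
    refine .lam ∅ fun z _ => ?_
    rw [LN.instAt_closeAt (closedAt_toLN S 0), LN.instAt_closeAt (closedAt_toLN P 0)]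
    refine (ih.lsub_fvar x z).mono ?_
    rintro _ ⟨_, ⟨st, hst | rfl, rfl⟩, rfl⟩
    · refine .inr ⟨st, hst, ?_⟩
      have h₁ : x ∉ st.1.toLN.fv := fun h => hΓ ⟨st, hst, .inl (QTm.mem_Fq_of_mem_fv h)⟩
      have h₂ : x ∉ st.2.toLN.fv := fun h => hΓ ⟨st, hst, .inr (QTm.mem_Fq_of_mem_fv h)⟩
      simp [Stmt.toLN, LN.lsub_of_notMem h₁, LN.lsub_of_notMem h₂]
    · left
      have : x ∉ Q.toLN.fv := by rwa [fv_toLN]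
      simp [Stmt.toLN, QTm.toLN_cls, Tm.toLN, LN.lsub, LN.lsub_of_notMem this]

theorem mono {Γ Δ : Set Stmt} {st : Stmt} (h : Derive Γ st) (hs : Γ ⊆ Δ) : Derive Δ st :=
  .cut (fun _ h' => .mem (hs h')) h

theorem exists_finite {Γ : Set Stmt} {st : Stmt} (h : Derive Γ st) :
    ∃ Δ ⊆ Γ, Δ.Finite ∧ Derive Δ st := by
  induction h with
  | @mem Γ st h => exact ⟨{st}, by simpa using h, Set.finite_singleton _, .mem rfl⟩
  | @cut Γ Δ st _ _ ih₁ ih₂ =>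
    obtain ⟨Δ', hΔ, hfin, hd⟩ := ih₂
    choose! f hf using ih₁
    refine ⟨⋃ st' ∈ Δ', f st', Set.iUnion₂_subset fun st' h => (hf st' (hΔ h)).1,
      hfin.biUnion fun st' h => (hf st' (hΔ h)).2.1, .cut (fun st' h => ?_) hd⟩
    exact (hf st' (hΔ h)).2.2.mono (Set.subset_biUnion_of_mem h)
  | app F S P R x => exact ⟨_, subset_rfl, by simp, .app F S P R x⟩
  | @ab Γ Q S P x hΓ hQ _ ih =>
    obtain ⟨Δ, hΔ, hfin, hd⟩ := ih
    refine ⟨Δ ∩ Γ, Set.inter_subset_right, hfin.inter_of_left _, .ab Q S P x ?_ hQ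
      (hd.mono fun st h => (hΔ h).imp (fun h' => ⟨h, h'⟩) id)⟩
    rintro ⟨st, hst, h⟩
    exact hΓ ⟨st, hst.2, h⟩

end Derive

/-- unique typing: if `Γ` is a context and `Γ ⊢ (S : P)` and
`Γ ⊢ (S : Q)`, then `P ≡_α Q`. -/
theorem derive_unique_typing (Γ : Set Stmt) (S P Q : Tm) :
    IsContext Γ → Derive Γ (cls S, cls P) → Derive Γ (cls S, cls Q) →
      AlphaEq P Q := by
  rintro ⟨hsub, hfun⟩ hP hQ
  obtain ⟨Δ, hΔ, hfin, hP⟩ := hP.exists_finite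
  obtain ⟨Δ', hΔ', hfin', hQ⟩ := hQ.exists_finite
  have hU : Δ ∪ Δ' ⊆ Γ := Set.union_subset hΔ hΔ'
  refine .of_toLN_eq ((hP.mono Set.subset_union_left).toTyping.unique
    (hQ.mono Set.subset_union_right).toTyping ((hfin.union hfin').image _) ?_ ?_ ?_)
  · rintro F A R ⟨st, hst, e⟩
    obtain ⟨T, hT, e'⟩ := hsub st (hU hst)
    simp only [Stmt.toLN, e', QTm.toLN_cls] at e
    cases T <;> simp_all [Tm.toLN, Tm.atomicOrRho]
  · rintro F A R ⟨st, hst, e⟩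
    obtain ⟨T, hT, e'⟩ := hsub st (hU hst)
    simp only [Stmt.toLN, e', QTm.toLN_cls] at e
    cases T <;> simp_all [Tm.toLN, Tm.atomicOrRho]
  · rintro s p q ⟨st, hst, e⟩ ⟨st', hst', e'⟩
    simp only [Stmt.toLN, Prod.mk.injEq] at e e'
    rw [← e.2, ← e'.2, hfun st (hU hst) st' (hU hst') (QTm.toLN_injective (e.1.trans e'.1.symm))]

end Paper
end

section
/- Head β-reduction is semantically valid in the second system: for any interpretation ⟦·⟧, terms R, S, T and variable x, if ⟦(λxRS)T⟧ is well-formed (⟦(λxRS)T⟧^wf holds) then ⟦S[T/x]⟧ is well-formed and ⟦(λxRS)T⟧ = ⟦S[T/x]⟧; since this holds for the interpretation modified by any assignment ψ of sets to variables, every interpretation satisfies the reduction statement ((λxRS)T ⊳⊳ S[T/x]). -/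
namespace Paper2

/-- Constants of the second system: among the constants we distinguish the
sorts `u n` and the polymorphic product operators `p m n`. -/
inductive Const : Type
  | u : ℕ → Const
  | p : ℕ → ℕ → Const
  | other : ℕ → Const
  deriving DecidableEq

/-- Terms of the second system (Part 2): constants, variables, applications
`βRS` and abstractions `λxRS` (no ρ-terms). -/
inductive Tm : Type
  | const : Const → Tm
  | var : ℕ → Tm
  | app : Tm → Tm → Tm
  | lam : ℕ → Tm → Tm → Tm
  deriving DecidableEq

namespace Tm

/-- The size of a term. -/
def size : Tm → ℕ
  | const _ => 1
  | var _ => 1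
  | app R S => R.size + S.size + 1
  | lam _ R S => R.size + S.size + 1

/-- The free variables `F(T)` of a term. -/
def fv : Tm → Finset ℕ
  | const _ => ∅
  | var x => {x}
  | app R S => R.fv ∪ S.fv
  | lam x R S => R.fv ∪ (S.fv \ {x})

/-- The bound variables `B(T)` of a term. -/
def bv : Tm → Finset ℕ
  | const _ => ∅
  | var _ => ∅
  | app R S => R.bv ∪ S.bv
  | lam x R S => (R.bv ∪ S.bv) ∪ {x}

/-- All variables `V(T) = F(T) ∪ B(T)` occurring in a term. -/
def vars (t : Tm) : Finset ℕ := t.fv ∪ t.bv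

/-- A fixed choice of a variable outside a given finite set of variables. -/
def fresh (s : Finset ℕ) : ℕ := s.sup id + 1

/-- Capture-avoiding renaming `S[z/y]`, with fuel, carrying size preservation. -/
def renameAux : (n : ℕ) → (S : Tm) → S.size ≤ n → (z y : ℕ) → {t : Tm // t.size = S.size}
  | _, const a, _, _, _ => ⟨const a, rfl⟩
  | _, var v, _, z, y => if v = y then ⟨var z, rfl⟩ else ⟨var v, rfl⟩
  | 0, app _ _, h, _, _ => absurd h (by simp only [size]; omega)
  | n + 1, app R S, h, z, y =>
      let R' := renameAux n R (by simp only [size] at h; omega) z y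
      let S' := renameAux n S (by simp only [size] at h; omega) z y
      ⟨app R'.1 S'.1, by simp only [size, R'.2, S'.2]⟩
  | 0, lam _ _ _, h, _, _ => absurd h (by simp only [size]; omega)
  | n + 1, lam w R S, h, z, y =>
      let R' := renameAux n R (by simp only [size] at h; omega) z y
      if w = y ∨ y ∉ S.fv then
        ⟨lam w R'.1 S, by simp only [size, R'.2]⟩
      else if w ≠ z then
        let S' := renameAux n S (by simp only [size] at h; omega) z y
        ⟨lam w R'.1 S'.1, by simp only [size, R'.2, S'.2]⟩
      else
        let z' := fresh ((var z).vars ∪ S.vars)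
        let S₁ := renameAux n S (by simp only [size] at h; omega) z' w
        let S₂ := renameAux n S₁.1 (by rw [S₁.2]; simp only [size] at h; omega) z y
        ⟨lam z' R'.1 S₂.1, by simp only [size, S₂.2, S₁.2, R'.2]⟩

/-- Capture-avoiding renaming `S[z/y]`. -/
def rename (S : Tm) (z y : ℕ) : Tm := (renameAux S.size S le_rfl z y).1

theorem size_rename (S : Tm) (z y : ℕ) : (rename S z y).size = S.size :=
  (renameAux S.size S le_rfl z y).2

/-- Capture-avoiding substitution `S[T/x]`. -/
def subst : Tm → Tm → ℕ → Tm
  | const a, _, _ => const a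
  | var v, T, x => if v = x then T else var v
  | app R S, T, x => app (subst R T x) (subst S T x)
  | lam w R S, T, x =>
      if w = x ∨ x ∉ S.fv then lam w (subst R T x) S
      else if w ∉ T.fv then lam w (subst R T x) (subst S T x)
      else lam (fresh (T.vars ∪ S.vars)) (subst R T x)
        (subst (rename S (fresh (T.vars ∪ S.vars)) w) T x)
termination_by S _ _ => S.size
decreasing_by all_goals (simp only [size, size_rename]; omega)

end Tm

open ZFSet

/-- The application `R(s) = ⋃ {r | ⟨r,s⟩ ∈ R}` of a set to a set. -/
noncomputable def sApp (R s : ZFSet.{0}) : ZFSet :=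
  ⋃₀ (ZFSet.sep (fun r => ZFSet.pair r s ∈ R) (⋃₀ (⋃₀ R)))

/-- The domain `dom(S) = {d | ∃ r, ⟨r,d⟩ ∈ S}` of a set. -/
noncomputable def sDom (S : ZFSet.{0}) : ZFSet :=
  ZFSet.sep (fun d => ∃ r, ZFSet.pair r d ∈ S) (⋃₀ (⋃₀ S))

/-- The range `ran(S) = {r | ∃ d, ⟨r,d⟩ ∈ S}` of a set. -/
noncomputable def sRan (S : ZFSet.{0}) : ZFSet :=
  ZFSet.sep (fun r => ∃ d, ZFSet.pair r d ∈ S) (⋃₀ (⋃₀ S))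

/-- `F` is a function (a set of pairs `⟨value, argument⟩`, functional in its
second component). -/
def IsFun (F : ZFSet.{0}) : Prop :=
  (∀ p ∈ F, ∃ r d, p = ZFSet.pair r d) ∧
    ∀ d r r', ZFSet.pair r d ∈ F → ZFSet.pair r' d ∈ F → r = r'

/-- The dependent product `∏φ` of a set `φ`: all functions `f` on `dom φ` with
`f(d) ∈ φ(d)` for all `d ∈ dom φ`. -/
noncomputable def dprod (F : ZFSet.{0}) : ZFSet :=
  ZFSet.sep
    (fun f => IsFun f ∧ sDom f = sDom F ∧ ∀ d ∈ sDom F, sApp f d ∈ sApp F d)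
    (ZFSet.powerset (ZFSet.prod (⋃₀ (sRan F)) (sDom F)))

/-- The set `Y^X` of all (set) functions from `X` to `Y`. -/
noncomputable def funcSet (Y X : ZFSet.{0}) : ZFSet :=
  ZFSet.sep (fun F => IsFun F ∧ sDom F = X) (ZFSet.powerset (ZFSet.prod Y X))

/-- The set `{⟨f r, r⟩ : r ∈ X}`. -/
noncomputable def lamSet (X : ZFSet.{0}) (f : ZFSet.{0} → ZFSet.{0}) : ZFSet :=
  @ZFSet.image (fun r => ZFSet.pair (f r) r) (Classical.allZFSetDefinable _) X

/-- An interpretation of the second system: values for the constants and the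
variables, where the value of each product operator `p m n` is the function on
`⟦u m⟧` sending each `D ∈ ⟦u m⟧` to the function taking each `φ ∈ ⟦u n⟧^D` to
the dependent product `∏φ`. -/
structure Interp where
  c : Const → ZFSet.{0}
  v : ℕ → ZFSet.{0}
  pSpec : ∀ m n : ℕ, c (Const.p m n) =
    lamSet (c (Const.u m)) (fun D => lamSet (funcSet (c (Const.u n)) D) (fun φ => dprod φ))

/-- The interpretation modified at the variable `x` to the set `r`. -/
noncomputable def Interp.update (I : Interp) (x : ℕ) (r : ZFSet.{0}) : Interp :=
  ⟨I.c, Function.update I.v x r, I.pSpec⟩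

/-- The interpretation `⟦·⟧_ψ` modified to agree with the assignment `ψ` of sets
to the variables. -/
noncomputable def Interp.withVars (I : Interp) (ψ : ℕ → ZFSet.{0}) : Interp :=
  ⟨I.c, ψ, I.pSpec⟩

/-- The interpretation of terms: `⟦βRS⟧ = ⟦R⟧(⟦S⟧)` and
`⟦λxRS⟧ = {⟨⟦S⟧_{⟨r,x⟩}, r⟩ : r ∈ ⟦R⟧}`. -/
noncomputable def interp : Tm → Interp → ZFSet.{0}
  | Tm.const a, I => I.c a
  | Tm.var x, I => I.v x
  | Tm.app R S, I => sApp (interp R I) (interp S I)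
  | Tm.lam x R S, I => lamSet (interp R I) (fun r => interp S (I.update x r))

/-- Well-formedness `⟦·⟧^wf` of a term with respect to an interpretation:
functions are only ever applied to members of their domains. -/
def WF : Tm → Interp → Prop
  | Tm.const _, _ => True
  | Tm.var _, _ => True
  | Tm.app F S, I => WF F I ∧ WF S I ∧ IsFun (interp F I) ∧ interp S I ∈ sDom (interp F I)
  | Tm.lam x R S, I => WF R I ∧ ∀ r, r ∈ interp R I → WF S (I.update x r)

end Paper2

namespace Paper2

theorem Tm.fresh_notMem (s : Finset ℕ) : Tm.fresh s ∉ s := by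
  intro h
  have := Finset.le_sup (f := id) h
  simp only [Tm.fresh, id] at this
  omega

@[simp]
theorem Interp.update_c (I : Interp) (x : ℕ) (r : ZFSet.{0}) : (I.update x r).c = I.c := rfl

@[simp]
theorem Interp.update_v (I : Interp) (x : ℕ) (r : ZFSet.{0}) :
    (I.update x r).v = Function.update I.v x r := rfl

/-- The interpretation and well-formedness of a term depend only on the values of the constants
and of its free variables. -/
theorem interp_WF_congr (S : Tm) {I J : Interp} (hc : I.c = J.c) (hv : ∀ y ∈ S.fv, I.v y = J.v y) :
    interp S I = interp S J ∧ (WF S I ↔ WF S J) := by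
  induction S generalizing I J with
  | const a => simp [interp, WF, hc]
  | var y => simpa [interp, WF] using hv y (by simp [Tm.fv])
  | app R S ihR ihS =>
    obtain ⟨eR, wR⟩ := ihR hc fun y hy => hv y (by simp [Tm.fv, hy])
    obtain ⟨eS, wS⟩ := ihS hc fun y hy => hv y (by simp [Tm.fv, hy])
    simp only [interp, WF, eR, eS, wR, wS, and_self]
  | lam w R S ihR ihS =>
    obtain ⟨eR, wR⟩ := ihR hc fun y hy => hv y (by simp [Tm.fv, hy])
    have hS (r) := ihS (I := I.update w r) (J := J.update w r) hc fun y hy => by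
      by_cases h : y = w
      · simp [h]
      · simpa [h] using hv y (by simp [Tm.fv, hy, h])
    simp only [interp, WF, eR, wR, (hS _).1, (hS _).2, and_self]

/-- Renaming commutes with the interpretation. -/
theorem interp_WF_renameAux (n : ℕ) (S : Tm) (h : S.size ≤ n) (z y : ℕ) (I : Interp) :
    interp (Tm.renameAux n S h z y).1 I = interp S (I.update y (I.v z)) ∧
      (WF (Tm.renameAux n S h z y).1 I ↔ WF S (I.update y (I.v z))) := by
  induction n generalizing S z y I with
  | zero => cases S <;> simp [Tm.size] at h
  | succ n ih =>
    cases S with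
    | const a => simp [Tm.renameAux, interp, WF]
    | var v =>
      by_cases hv : v = y <;> simp [Tm.renameAux, interp, WF, hv]
    | app R S =>
      simp only [Tm.renameAux, interp, WF, (ih _ _ _ _ _).1, (ih _ _ _ _ _).2, and_self]
    | lam w R S =>
      simp only [Tm.renameAux]
      split_ifs with h₁ h₂
      · have hS (r) := interp_WF_congr S (I := (I.update y (I.v z)).update w r)
          (J := I.update w r) rfl fun u hu => by
            simp only [Interp.update_v, Function.update_apply]
            grind
        simp only [interp, WF, (ih _ _ _ _ _).1, (ih _ _ _ _ _).2, (hS _).1, (hS _).2, and_self]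
      · have hS (r) := interp_WF_congr S (I := (I.update y (I.v z)).update w r)
          (J := (I.update w r).update y ((I.update w r).v z)) rfl fun u hu => by
            simp only [Interp.update_v, Function.update_apply]
            grind
        simp only [interp, WF, (ih _ _ _ _ _).1, (ih _ _ _ _ _).2, (hS _).1, (hS _).2, and_self]
      · have hf := Tm.fresh_notMem ((Tm.var z).vars ∪ S.vars)
        simp only [interp, WF, (ih _ _ _ _ _).1, (ih _ _ _ _ _).2]
        generalize Tm.fresh ((Tm.var z).vars ∪ S.vars) = z' at hf ⊢
        simp only [Tm.vars, Tm.fv, Tm.bv, Finset.mem_union, Finset.mem_singleton] at hf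
        have hS (r) := interp_WF_congr S (I := (I.update y (I.v z)).update w r)
          (J := ((I.update z' r).update y ((I.update z' r).v z)).update w
            (((I.update z' r).update y ((I.update z' r).v z)).v z')) rfl fun u hu => by
            simp only [Interp.update_v, Function.update_apply]
            grind
        simp only [(hS _).1, (hS _).2, and_self]

theorem interp_WF_rename (S : Tm) (z y : ℕ) (I : Interp) :
    interp (S.rename z y) I = interp S (I.update y (I.v z)) ∧
      (WF (S.rename z y) I ↔ WF S (I.update y (I.v z))) :=
  interp_WF_renameAux _ _ _ _ _ _

/-- Substituting a well-formed term commutes with the interpretation. -/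
theorem interp_WF_subst (S T : Tm) (x : ℕ) (I : Interp) (hT : WF T I) :
    interp (S.subst T x) I = interp S (I.update x (interp T I)) ∧
      (WF (S.subst T x) I ↔ WF S (I.update x (interp T I))) := by
  induction hn : S.size using Nat.strong_induction_on generalizing S I with
  | _ n ih =>
  subst hn
  cases S with
  | const a => simp [Tm.subst, interp, WF]
  | var v =>
    by_cases hv : v = x <;> simp [Tm.subst, interp, WF, hv, hT]
  | app R S =>
    have hR := ih R.size (by simp only [Tm.size]; omega) R I hT rfl
    have hS := ih S.size (by simp only [Tm.size]; omega) S I hT rfl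
    simp only [Tm.subst, interp, WF, hR.1, hR.2, hS.1, hS.2, and_self]
  | lam w R S =>
    have hR := ih R.size (by simp only [Tm.size]; omega) R I hT rfl
    have hT' (z) (hz : z ∉ T.fv) (r) := interp_WF_congr T (I := I.update z r) (J := I) rfl
      fun u hu => by
        simp only [Interp.update_v, Function.update_apply]
        grind
    rw [Tm.subst]
    split_ifs with h₁ h₂
    · have hS (r) := interp_WF_congr S (I := (I.update x (interp T I)).update w r)
        (J := I.update w r) rfl fun u hu => by
          simp only [Interp.update_v, Function.update_apply]
          clear ih hR
          grind
      simp only [interp, WF, hR.1, hR.2, (hS _).1, (hS _).2, and_self]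
    · have hf := Tm.fresh_notMem (T.vars ∪ S.vars)
      generalize Tm.fresh (T.vars ∪ S.vars) = z at hf ⊢
      simp only [Tm.vars, Finset.mem_union, not_or] at hf
      have hz : z ∉ T.fv := hf.1.1
      have hS (r) := ih (S.rename z w).size (by simp only [Tm.size, Tm.size_rename]; omega)
        (S.rename z w) (I.update z r) ((hT' z hz r).2.2 hT) rfl
      have hS' (r) := interp_WF_congr S (I := (I.update x (interp T I)).update w r)
        (J := ((I.update z r).update x (interp T (I.update z r))).update w
          (((I.update z r).update x (interp T (I.update z r))).v z)) rfl fun u hu => by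
          simp only [Interp.update_v, Function.update_apply, (hT' z hz r).1]
          clear ih hR
          grind
      simp only [interp, WF, hR.1, hR.2, (hS _).1, (hS _).2, (interp_WF_rename _ _ _ _).1,
        (interp_WF_rename _ _ _ _).2, (hS' _).1, (hS' _).2, and_self]
    · have hS (r) := ih S.size (by simp only [Tm.size]; omega) S (I.update w r)
        ((hT' w h₂ r).2.2 hT) rfl
      have hS' (r) := interp_WF_congr S (I := (I.update x (interp T I)).update w r)
        (J := (I.update w r).update x (interp T (I.update w r))) rfl fun u hu => by
          simp only [Interp.update_v, Function.update_apply, (hT' w h₂ r).1]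
          clear ih hR
          grind
      simp only [interp, WF, hR.1, hR.2, (hS _).1, (hS _).2, (hS' _).1, (hS' _).2, and_self]

theorem pair_mem_lamSet {X : ZFSet.{0}} {f : ZFSet.{0} → ZFSet.{0}} {a b : ZFSet.{0}} :
    ZFSet.pair a b ∈ lamSet X f ↔ b ∈ X ∧ a = f b := by
  simp only [lamSet, ZFSet.mem_image, ZFSet.pair_inj]
  grind

theorem mem_of_mem_sDom_lamSet {X : ZFSet.{0}} {f : ZFSet.{0} → ZFSet.{0}} {d : ZFSet.{0}}
    (h : d ∈ sDom (lamSet X f)) : d ∈ X := by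
  obtain ⟨-, r, hr⟩ := ZFSet.mem_sep.1 h
  exact (pair_mem_lamSet.1 hr).1

theorem sApp_lamSet {X : ZFSet.{0}} {f : ZFSet.{0} → ZFSet.{0}} {d : ZFSet.{0}} (hd : d ∈ X) :
    sApp (lamSet X f) d = f d := by
  have hp : ZFSet.pair (f d) d ∈ lamSet X f := pair_mem_lamSet.2 ⟨hd, rfl⟩
  have hm : f d ∈ ZFSet.sUnion (ZFSet.sUnion (lamSet X f)) :=
    ZFSet.mem_sUnion.2 ⟨{f d, d}, ZFSet.mem_sUnion.2 ⟨_, hp, by simp [ZFSet.pair]⟩, by simp⟩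
  ext u
  simp only [sApp, ZFSet.mem_sUnion (x := ZFSet.sep _ _), ZFSet.mem_sep, pair_mem_lamSet]
  constructor
  · rintro ⟨_, ⟨-, -, rfl⟩, hu⟩
    exact hu
  · exact fun hu => ⟨f d, ⟨hm, hd, rfl⟩, hu⟩

/-- head β-reduction is semantically valid: for every assignment
`ψ` of sets to the variables, if `⟦(λxRS)T⟧_ψ` is well-formed then so is
`⟦S[T/x]⟧_ψ` and the two interpretations agree; i.e. every interpretation
satisfies the reduction statement `((λxRS)T ⊳⊳ S[T/x])`. -/
theorem head_beta_reduction (I : Interp) (R S T : Tm) (x : ℕ) :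
    ∀ ψ : ℕ → ZFSet.{0},
      WF (Tm.app (Tm.lam x R S) T) (I.withVars ψ) →
        WF (S.subst T x) (I.withVars ψ) ∧
          interp (Tm.app (Tm.lam x R S) T) (I.withVars ψ)
            = interp (S.subst T x) (I.withVars ψ) := by
  rintro ψ ⟨⟨-, hS⟩, hT, -, hd⟩
  have hd := mem_of_mem_sDom_lamSet hd
  obtain ⟨e, w⟩ := interp_WF_subst S T x (I.withVars ψ) hT
  exact ⟨w.2 (hS _ hd), (sApp_lamSet hd).trans e.symm⟩

end Paper2
end
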